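/- arXiv:2603.18215 — 2 statements merged into one kernel-verified Lean document; each statement's English description precedes it below -/
import Mathlib

section
/- For n = 3 and k = 2, the convex hull of Q_{3,2} equals the spartrahedron: conv(Q_{3,2}) = S_{3,2}. -/
open Matrix Finset

/-- Number of nonzero entries of a vector. -/
noncomputable def sparsity {n : ℕ} (x : Fin n → ℝ) : ℕ :=
  (Finset.univ.filter fun i => x i ≠ 0).card

/-- The `k`-spartrahedron: symmetric matrices with `k·diag(X) ⪰ X ⪰ 0`. -/
def Spartra (n k : ℕ) : Set (Matrix (Fin n) (Fin n) ℝ) :=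
  {X | ((k : ℝ) • Matrix.diagonal (fun i => X i i) - X).PosSemidef ∧ X.PosSemidef}

/-- The set of rank-one matrices `x xᵀ` with `‖x‖₀ ≤ k`. -/
def Qset (n k : ℕ) : Set (Matrix (Fin n) (Fin n) ℝ) :=
  {X | ∃ x : Fin n → ℝ, sparsity x ≤ k ∧ X = Matrix.vecMulVec x x}

lemma aux_two (a b p : ℝ) (ha : 0 ≤ a) (hb : 0 ≤ b) (h : p ^ 2 ≤ a * b) :
    ∃ u v w : ℝ, a = u * u ∧ p = u * v ∧ b = v * v + w * w := by
  rcases ha.eq_or_lt with h0 | h0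
  · refine ⟨0, 0, √b, by simp [← h0], ?_, by simp [Real.mul_self_sqrt hb]⟩
    have : p ^ 2 = 0 := le_antisymm (by rw [← h0] at h; simpa using h) (sq_nonneg p)
    simpa using this
  · have hs : 0 < √a := Real.sqrt_pos.mpr h0
    have hss : √a * √a = a := Real.mul_self_sqrt ha
    have hw : 0 ≤ b - p ^ 2 / a := by
      rw [sub_nonneg, div_le_iff₀ h0]; linarith
    refine ⟨√a, p / √a, √(b - p ^ 2 / a), hss.symm, by field_simp, ?_⟩
    rw [Real.mul_self_sqrt hw, div_mul_div_comm, hss]; ring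

lemma aux_split_le (a b c p q r : ℝ) (ha : 0 ≤ a) (hb : 0 ≤ b) (hc : 0 ≤ c)
    (hp : 0 ≤ p) (hq : 0 ≤ q) (hr : 0 ≤ r)
    (hab : p ^ 2 ≤ a * b) (hac : q ^ 2 ≤ a * c) (hbc : r ^ 2 ≤ b * c)
    (hd : 0 ≤ a * b * c - 2 * p * q * r - a * r ^ 2 - b * q ^ 2 - c * p ^ 2) :
    ∃ a1 a2 b1 b2 c1 c2 : ℝ, 0 ≤ a1 ∧ 0 ≤ a2 ∧ 0 ≤ b1 ∧ 0 ≤ b2 ∧ 0 ≤ c1 ∧ 0 ≤ c2 ∧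
      a1 + a2 ≤ a ∧ b1 + b2 ≤ b ∧ c1 + c2 ≤ c ∧
      p ^ 2 ≤ a1 * b1 ∧ q ^ 2 ≤ a2 * c1 ∧ r ^ 2 ≤ b2 * c2 := by
  rcases hp.eq_or_lt with rfl | hp'
  · -- p = 0 : path through c
    rcases ha.eq_or_lt with rfl | ha'
    · have : q = 0 := by nlinarith
      subst this
      exact ⟨0, 0, 0, b, 0, c, by simp, by simp, by simp, hb, by simp, hc, by simp, by simp,
        by simp, by simp, by simp, hbc⟩
    · have hx : 0 ≤ c - q ^ 2 / a := by rw [sub_nonneg, div_le_iff₀ ha']; linarith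
      refine ⟨0, a, 0, b, q ^ 2 / a, c - q ^ 2 / a, by simp, ha, by simp, hb, by positivity, hx,
        by simp, by simp, by simp, by simp, by field_simp; simp, ?_⟩
      have : b * (c - q ^ 2 / a) = (a * b * c - b * q ^ 2) / a := by field_simp
      rw [this, le_div_iff₀ ha']; nlinarith
  rcases hq.eq_or_lt with rfl | hq'
  · have ha' : 0 < a := by
      rcases ha.eq_or_lt with rfl | h
      · nlinarith
      · exact h
    have hx : 0 ≤ b - p ^ 2 / a := by rw [sub_nonneg, div_le_iff₀ ha']; linarith
    refine ⟨a, 0, p ^ 2 / a, b - p ^ 2 / a, 0, c, ha, by simp, by positivity, hx, by simp, hc,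
      by simp, by simp, by simp, by field_simp; simp, by simp, ?_⟩
    have : (b - p ^ 2 / a) * c = (a * b * c - c * p ^ 2) / a := by field_simp
    rw [this, le_div_iff₀ ha']; nlinarith
  have ha' : 0 < a := by
    rcases ha.eq_or_lt with rfl | h
    · nlinarith
    · exact h
  -- main case, scaled: B = a b - p^2, R = a r + p q, C = a c - q^2
  obtain ⟨B, hB⟩ : ∃ B, B = a * b - p ^ 2 := ⟨_, rfl⟩
  obtain ⟨C, hC⟩ : ∃ C, C = a * c - q ^ 2 := ⟨_, rfl⟩
  obtain ⟨R, hR⟩ : ∃ R, R = a * r + p * q := ⟨_, rfl⟩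
  have hRp : 0 < R := by rw [hR]; positivity
  have hBC : R ^ 2 ≤ B * C := by
    have : B * C - R ^ 2 =
      a * (a * b * c - 2 * p * q * r - a * r ^ 2 - b * q ^ 2 - c * p ^ 2) := by
      rw [hB, hC, hR]; ring
    nlinarith [mul_nonneg ha hd]
  have hB0 : 0 ≤ B := by linarith
  have hBp : 0 < B := by
    rcases hB0.eq_or_lt with h | h
    · rw [← h] at hBC; nlinarith
    · exact h
  obtain ⟨v, hv⟩ : ∃ v, v = (p * R + q * B) / a := ⟨_, rfl⟩
  have hvp : 0 < v := by rw [hv]; positivity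
  have hva : v * a = p * R + q * B := by rw [hv]; field_simp
  refine ⟨p * R / v, q * B / v, p * v / R, r * B / R, q * v / B, r * R / B, by positivity,
    by positivity, by positivity, by positivity, by positivity, by positivity, ?_, ?_, ?_,
    ?_, ?_, ?_⟩
  · rw [← add_div, div_le_iff₀ hvp]; linarith
  · rw [← add_div, div_le_iff₀ hRp]
    apply le_of_mul_le_mul_left _ ha'
    have : a * (p * v + r * B) = p * (p * R + q * B) + a * r * B := by rw [← hva]; ring
    rw [this]
    have : a * (b * R) - (p * (p * R + q * B) + a * r * B) = 0 := by
      have e : a * b = B + p ^ 2 := by linarith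
      have e2 : a * r = R - p * q := by linarith
      rw [← mul_assoc, e, e2]; ring
    linarith
  · rw [← add_div, div_le_iff₀ hBp]
    apply le_of_mul_le_mul_left _ ha'
    have : a * (q * v + r * R) = q * (p * R + q * B) + a * r * R := by rw [← hva]; ring
    rw [this]
    have e : a * c = C + q ^ 2 := by linarith
    have e2 : a * r = R - p * q := by linarith
    rw [← mul_assoc, e, e2]; nlinarith
  · apply le_of_eq; field_simp
  · apply le_of_eq; field_simp
  · apply le_of_eq; field_simp

lemma aux_split (a b c p q r : ℝ) (ha : 0 ≤ a) (hb : 0 ≤ b) (hc : 0 ≤ c)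
    (hab : p ^ 2 ≤ a * b) (hac : q ^ 2 ≤ a * c) (hbc : r ^ 2 ≤ b * c)
    (hd : 0 ≤ a * b * c - 2 * p * q * r - a * r ^ 2 - b * q ^ 2 - c * p ^ 2)
    (hd' : 0 ≤ a * b * c + 2 * p * q * r - a * r ^ 2 - b * q ^ 2 - c * p ^ 2) :
    ∃ a1 a2 b1 b2 c1 c2 : ℝ, 0 ≤ a1 ∧ 0 ≤ a2 ∧ 0 ≤ b1 ∧ 0 ≤ b2 ∧ 0 ≤ c1 ∧ 0 ≤ c2 ∧
      a1 + a2 = a ∧ b1 + b2 = b ∧ c1 + c2 = c ∧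
      p ^ 2 ≤ a1 * b1 ∧ q ^ 2 ≤ a2 * c1 ∧ r ^ 2 ≤ b2 * c2 := by
  have hdd : 0 ≤ a * b * c - 2 * |p| * |q| * |r| - a * |r| ^ 2 - b * |q| ^ 2 - c * |p| ^ 2 := by
    simp only [sq_abs]
    have : 2 * |p| * |q| * |r| = 2 * |p * q * r| := by rw [abs_mul, abs_mul]; ring
    rw [this]
    rcases abs_cases (p * q * r) with h | h <;> rw [h.1] <;> linarith
  obtain ⟨a1, a2, b1, b2, c1, c2, h1, h2, h3, h4, h5, h6, h7, h8, h9, h10, h11, h12⟩ :=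
    aux_split_le a b c |p| |q| |r| ha hb hc (abs_nonneg _) (abs_nonneg _) (abs_nonneg _)
      (by simpa using hab) (by simpa using hac) (by simpa using hbc) hdd
  simp only [sq_abs] at h10 h11 h12
  refine ⟨a1, a - a1, b1, b - b1, c1, c - c1, h1, by linarith, h3, by linarith, h5, by linarith,
    by ring, by ring, by ring, h10, ?_, ?_⟩
  · exact h11.trans (mul_le_mul_of_nonneg_right (by linarith) h5)
  · exact h12.trans (mul_le_mul (by linarith) (by linarith) h6 (by linarith))

lemma Qset_smul (n k : ℕ) (X : Matrix (Fin n) (Fin n) ℝ) (hX : X ∈ Qset n k) :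
    (2 : ℝ) • X ∈ Qset n k := by
  obtain ⟨x, hx, rfl⟩ := hX
  refine ⟨√2 • x, ?_, ?_⟩
  · simpa [sparsity] using hx
  · ext i j
    have : √2 * √2 = (2 : ℝ) := Real.mul_self_sqrt (by norm_num)
    simp only [Matrix.smul_apply, vecMulVec_apply, Pi.smul_apply, smul_eq_mul]
    linear_combination (- (x i * x j)) * this

lemma hull_smul (n k : ℕ) (X : Matrix (Fin n) (Fin n) ℝ) (hX : X ∈ convexHull ℝ (Qset n k)) :
    (2 : ℝ) • X ∈ convexHull ℝ (Qset n k) := by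
  have h := (convex_convexHull ℝ (Qset n k)).linear_preimage
    ((2 : ℝ) • (LinearMap.id : Matrix (Fin n) (Fin n) ℝ →ₗ[ℝ] _))
  refine convexHull_min ?_ h hX
  intro Y hY
  exact subset_convexHull ℝ (Qset n k) (Qset_smul n k Y hY)

lemma hull_add (n k : ℕ) (X Y : Matrix (Fin n) (Fin n) ℝ) (hX : X ∈ convexHull ℝ (Qset n k))
    (hY : Y ∈ convexHull ℝ (Qset n k)) : X + Y ∈ convexHull ℝ (Qset n k) := by
  have := convex_convexHull ℝ (Qset n k) (hull_smul n k X hX) (hull_smul n k Y hY)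
    (a := 1/2) (b := 1/2) (by norm_num) (by norm_num) (by norm_num)
  simpa [smul_smul] using this

lemma mem_hull (x : Fin 3 → ℝ) (i : Fin 3) (h : x i = 0) :
    vecMulVec x x ∈ convexHull ℝ (Qset 3 2) := by
  refine subset_convexHull ℝ _ ⟨x, ?_, rfl⟩
  unfold sparsity
  have : (Finset.univ.filter fun i => x i ≠ 0) ⊆ Finset.univ.erase i := by
    intro j hj
    simp only [Finset.mem_filter, Finset.mem_univ, true_and] at hj
    simp only [Finset.mem_erase, Finset.mem_univ, and_true]
    rintro rfl; exact hj h
  calc _ ≤ _ := Finset.card_le_card this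
    _ = 2 := by simp

lemma exists_zero (x : Fin 3 → ℝ) (h : sparsity x ≤ 2) : ∃ i, x i = 0 := by
  by_contra! hne
  have : sparsity x = 3 := by simp [sparsity, hne]
  omega

lemma spartra_convex : Convex ℝ (Spartra 3 2) := by
  intro X hX Y hY a b ha hb _
  refine ⟨?_, (hX.2.smul ha).add (hY.2.smul hb)⟩
  have := (hX.1.smul ha).add (hY.1.smul hb)
  convert this using 1
  ext i j
  by_cases hij : i = j
  · subst hij; simp; ring
  · simp [hij]; ring

lemma Q_sub : Qset 3 2 ⊆ Spartra 3 2 := by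
  rintro _ ⟨x, hx, rfl⟩
  obtain ⟨i, hi⟩ := exists_zero x hx
  refine ⟨?_, ?_⟩
  · refine PosSemidef.of_dotProduct_mulVec_nonneg ?_ ?_
    · ext i j
      by_cases hij : i = j
      · subst hij; simp
      · simp [hij, Ne.symm hij, vecMulVec_apply, mul_comm]
    · intro y
      simp [dotProduct, mulVec, Fin.sum_univ_three, vecMulVec_apply, diagonal]
      fin_cases i <;> simp at hi <;> simp [hi]
      · nlinarith [sq_nonneg (x 1 * y 1 - x 2 * y 2)]
      · nlinarith [sq_nonneg (x 0 * y 0 - x 2 * y 2)]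
      · nlinarith [sq_nonneg (x 0 * y 0 - x 1 * y 1)]
  · simpa using posSemidef_vecMulVec_self_star x

lemma minor_two {X : Matrix (Fin 3) (Fin 3) ℝ} (h : X.PosSemidef) (i j : Fin 3) :
    X i j ^ 2 ≤ X i i * X j j := by
  have := (h.submatrix ![i, j]).det_nonneg
  have hs : X j i = X i j := by simpa using h.1.apply i j
  rw [det_fin_two] at this
  simp [hs] at this
  nlinarith

theorem convexHull_Q_eq_spartra_three_two :
    convexHull ℝ (Qset 3 2) = Spartra 3 2 := by
  apply Set.Subset.antisymm (convexHull_min Q_sub spartra_convex)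
  rintro X ⟨h1, h2⟩
  have s1 : X 1 0 = X 0 1 := by simpa using h2.1.apply 0 1
  have s2 : X 2 0 = X 0 2 := by simpa using h2.1.apply 0 2
  have s3 : X 2 1 = X 1 2 := by simpa using h2.1.apply 1 2
  have d1 := h1.det_nonneg
  have d2 := h2.det_nonneg
  simp [det_fin_three, s1, s2, s3] at d1 d2
  obtain ⟨a1, a2, b1, b2, c1, c2, k1, k2, k3, k4, k5, k6, ka, kb, kc, k10, k11, k12⟩ :=
    aux_split (X 0 0) (X 1 1) (X 2 2) (X 0 1) (X 0 2) (X 1 2) h2.diag_nonneg h2.diag_nonneg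
      h2.diag_nonneg (minor_two h2 0 1) (minor_two h2 0 2) (minor_two h2 1 2)
      (by nlinarith) (by nlinarith)
  obtain ⟨u, v, w, e1, e2, e3⟩ := aux_two _ _ _ k1 k3 k10
  obtain ⟨u', v', w', e1', e2', e3'⟩ := aux_two _ _ _ k2 k5 k11
  obtain ⟨u'', v'', w'', e1'', e2'', e3''⟩ := aux_two _ _ _ k4 k6 k12
  have key : X = vecMulVec ![u, v, 0] ![u, v, 0] + vecMulVec ![0, w, 0] ![0, w, 0]
      + (vecMulVec ![u', 0, v'] ![u', 0, v'] + vecMulVec ![0, 0, w'] ![0, 0, w'])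
      + (vecMulVec ![0, u'', v''] ![0, u'', v''] + vecMulVec ![0, 0, w''] ![0, 0, w'']) := by
    ext i j
    fin_cases i <;> fin_cases j <;> simp [vecMulVec_apply, s1, s2, s3] <;> linarith
  rw [key]
  refine hull_add _ _ _ _ (hull_add _ _ _ _ (hull_add _ _ _ _ ?_ ?_) (hull_add _ _ _ _ ?_ ?_))
    (hull_add _ _ _ _ ?_ ?_)
  · exact mem_hull _ 2 (by simp)
  · exact mem_hull _ 0 (by simp)
  · exact mem_hull _ 1 (by simp)
  · exact mem_hull _ 0 (by simp)
  · exact mem_hull _ 0 (by simp)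
  · exact mem_hull _ 0 (by simp)
end

section
/- If Σ = σσᵀ for some σ ∈ ℝⁿ, then the spartrahedron SDP relaxation of sparse PCA is exact: its optimal value v̄* equals the sparse PCA value v*, and there is an optimal solution of the SDP of the form x xᵀ with ‖x‖₂ = 1 and ‖x‖₀ ≤ k. -/
open Matrix Finset

/-- The set of objective values of the sparse PCA problem for `M`. -/
def PCAVals (n k : ℕ) (M : Matrix (Fin n) (Fin n) ℝ) : Set ℝ :=
  {v | ∃ x : Fin n → ℝ, (∑ i, (x i) ^ 2) = 1 ∧ sparsity x ≤ k ∧ v = x ⬝ᵥ (M *ᵥ x)}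

/-- The set of objective values of the spartrahedron SDP relaxation for `M`. -/
def PCASDPVals (n k : ℕ) (M : Matrix (Fin n) (Fin n) ℝ) : Set ℝ :=
  {v | ∃ X ∈ Spartra n k, X.trace = 1 ∧ v = (M * X).trace}

theorem aux_cs {n : ℕ} {X : Matrix (Fin n) (Fin n) ℝ} (hX : X.PosSemidef) (u v : Fin n → ℝ)
    (hs : 0 < v ⬝ᵥ (X *ᵥ v)) :
    (u ⬝ᵥ (X *ᵥ v)) ^ 2 ≤ (u ⬝ᵥ (X *ᵥ u)) * (v ⬝ᵥ (X *ᵥ v)) := by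
  have hsym : v ⬝ᵥ (X *ᵥ u) = u ⬝ᵥ (X *ᵥ v) := by
    have h : Xᵀ = X := by simpa using hX.isHermitian.eq
    rw [dotProduct_mulVec, ← mulVec_transpose, h, dotProduct_comm]
  have h := hX.dotProduct_mulVec_nonneg
    ((v ⬝ᵥ (X *ᵥ v)) • u - (u ⬝ᵥ (X *ᵥ v)) • v)
  simp only [star_trivial, mulVec_sub, mulVec_smul, sub_dotProduct, dotProduct_sub,
    smul_dotProduct, dotProduct_smul, smul_eq_mul, hsym] at h
  generalize v ⬝ᵥ (X *ᵥ v) = s at *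
  generalize u ⬝ᵥ (X *ᵥ v) = b at *
  generalize u ⬝ᵥ (X *ᵥ u) = c at *
  have h2 : 0 ≤ s * (c * s - b ^ 2) := by nlinarith
  have := nonneg_of_mul_nonneg_right h2 hs
  linarith

theorem aux_spart {n k : ℕ} {X : Matrix (Fin n) (Fin n) ℝ}
    (h : ((k : ℝ) • Matrix.diagonal (fun i => X i i) - X).PosSemidef) (u : Fin n → ℝ) :
    u ⬝ᵥ (X *ᵥ u) ≤ k * ∑ i, X i i * u i ^ 2 := by
  have h := h.dotProduct_mulVec_nonneg u
  simp only [star_trivial, sub_mulVec, smul_mulVec, dotProduct_sub, dotProduct_smul,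
    smul_eq_mul] at h
  have e : u ⬝ᵥ (Matrix.diagonal (fun i => X i i) *ᵥ u) = ∑ i, X i i * u i ^ 2 := by
    simp only [dotProduct, mulVec_diagonal]
    exact Finset.sum_congr rfl fun i _ => by ring
  rw [e] at h
  linarith

theorem aux_mem {n k : ℕ} (x : Fin n → ℝ) (hx : sparsity x ≤ k) :
    Matrix.vecMulVec x x ∈ Spartra n k := by
  have hp : (Matrix.vecMulVec x x).PosSemidef := by
    simpa using posSemidef_vecMulVec_self_star x
  refine ⟨?_, hp⟩
  refine PosSemidef.of_dotProduct_mulVec_nonneg ?_ ?_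
  · refine IsHermitian.sub ?_ hp.isHermitian
    ext i j
    by_cases hij : i = j
    · subst hij; simp
    · simp [Matrix.diagonal, hij, Ne.symm hij]
  · intro u
    simp only [star_trivial, sub_mulVec, smul_mulVec, dotProduct_sub, dotProduct_smul, smul_eq_mul]
    have e : u ⬝ᵥ (Matrix.diagonal (fun i => vecMulVec x x i i) *ᵥ u) = ∑ i, (x i * u i) ^ 2 := by
      simp only [dotProduct, mulVec_diagonal, vecMulVec_apply]
      exact Finset.sum_congr rfl fun i _ => by ring
    have e2 : u ⬝ᵥ (vecMulVec x x *ᵥ u) = (∑ i, x i * u i) ^ 2 := by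
      rw [vecMulVec_mulVec]
      simp only [dotProduct_smul, op_smul_eq_smul, smul_eq_mul]
      rw [dotProduct_comm u x, sq]; rfl
    rw [e, e2]
    set T := Finset.univ.filter fun i => x i ≠ 0 with hT
    have s1 : ∑ i, x i * u i = ∑ i ∈ T, x i * u i := by
      symm
      apply Finset.sum_subset (Finset.subset_univ _)
      intro i _ hi
      have : x i = 0 := by simpa [hT] using hi
      simp [this]
    have h1 : (∑ i ∈ T, x i * u i) ^ 2 ≤ (T.card : ℝ) * ∑ i ∈ T, (x i * u i) ^ 2 :=
      sq_sum_le_card_mul_sum_sq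
    have h2 : ∑ i ∈ T, (x i * u i) ^ 2 ≤ ∑ i, (x i * u i) ^ 2 :=
      Finset.sum_le_sum_of_subset_of_nonneg (Finset.subset_univ _) fun i _ _ => sq_nonneg _
    have h3 : (T.card : ℝ) ≤ k := by exact_mod_cast hx
    have h4 : (T.card : ℝ) * ∑ i ∈ T, (x i * u i) ^ 2 ≤ k * ∑ i, (x i * u i) ^ 2 :=
      mul_le_mul h3 h2 (Finset.sum_nonneg fun i _ => sq_nonneg _) (by positivity)
    rw [s1]
    linarith

theorem aux_top {n k : ℕ} (hk : 1 ≤ k) (hkn : k ≤ n) (a t : Fin n → ℝ) (ha : ∀ i, 0 ≤ a i)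
    (h0 : ∀ i, 0 ≤ t i) (h1 : ∀ i, t i ≤ 1) (hs : ∑ i, t i ≤ k) :
    ∃ T : Finset (Fin n), T.card = k ∧ ∑ i, t i * a i ≤ ∑ i ∈ T, a i := by
  have hne : (Finset.powersetCard k (Finset.univ : Finset (Fin n))).Nonempty := by
    apply Finset.powersetCard_nonempty_of_le; simpa using hkn
  obtain ⟨T, hT, hmax⟩ := Finset.exists_max_image _ (fun T => ∑ i ∈ T, a i) hne
  have hc : T.card = k := (Finset.mem_powersetCard.1 hT).2
  refine ⟨T, hc, ?_⟩
  have hTne : T.Nonempty := by rw [← Finset.card_pos]; omega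
  obtain ⟨m, hm, hmin⟩ := Finset.exists_min_image T a hTne
  have hout : ∀ j, j ∉ T → a j ≤ a m := by
    intro j hj
    have hj' : j ∉ T.erase m := fun h => hj (Finset.mem_of_mem_erase h)
    have := hmax (insert j (T.erase m)) (by
      rw [Finset.mem_powersetCard]
      refine ⟨Finset.subset_univ _, ?_⟩
      rw [Finset.card_insert_of_notMem hj', Finset.card_erase_of_mem hm]
      omega)
    simp only [Finset.sum_insert hj'] at this
    have h2 := Finset.add_sum_erase T a hm
    linarith
  have key : ∑ i, t i * (a i - a m) ≤ ∑ i ∈ T, (a i - a m) := by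
    rw [← Finset.sum_filter_add_sum_filter_not Finset.univ (fun i => i ∈ T)]
    have e : Finset.univ.filter (fun i => i ∈ T) = T := by ext; simp
    rw [e]
    have k1 : ∑ i ∈ T, t i * (a i - a m) ≤ ∑ i ∈ T, (a i - a m) :=
      Finset.sum_le_sum fun i hi => by nlinarith [hmin i hi, h1 i]
    have k2 : ∑ i ∈ Finset.univ.filter (fun i => ¬ i ∈ T), t i * (a i - a m) ≤ 0 :=
      Finset.sum_nonpos fun i hi => by
        have := hout i (Finset.mem_filter.1 hi).2
        nlinarith [h0 i]
    linarith
  simp only [mul_sub, Finset.sum_sub_distrib, ← Finset.sum_mul, Finset.sum_const, hc,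
    nsmul_eq_mul] at key
  have := mul_le_mul_of_nonneg_right hs (ha m)
  linarith

theorem aux_bound {n k : ℕ} (hk : 1 ≤ k) (hkn : k ≤ n) (σ : Fin n → ℝ)
    {X : Matrix (Fin n) (Fin n) ℝ} (hX : X ∈ Spartra n k) (ht : X.trace = 1) :
    ∃ T : Finset (Fin n), T.card = k ∧ σ ⬝ᵥ (X *ᵥ σ) ≤ ∑ i ∈ T, σ i ^ 2 := by
  obtain ⟨hK, hP⟩ := hX
  rcases le_or_gt (σ ⬝ᵥ (X *ᵥ σ)) 0 with hs | hs
  · obtain ⟨T, -, hT⟩ := Finset.exists_subset_card_eq (s := (Finset.univ : Finset (Fin n)))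
      (n := k) (by simpa using hkn)
    exact ⟨T, hT, hs.trans (Finset.sum_nonneg fun i _ => sq_nonneg _)⟩
  have hcs := fun u => aux_cs hP u σ hs
  set z := X *ᵥ σ with hz
  set s := σ ⬝ᵥ z with hs'
  have hw : ∀ i, 0 ≤ X i i := fun i => hP.diag_nonneg
  have hzi : ∀ i, z i ^ 2 ≤ X i i * s := by
    intro i
    have := hcs (Pi.single i 1)
    simpa using this
  have hz0 : ∀ i, X i i = 0 → z i = 0 := by
    intro i h
    have := hzi i
    rw [h, zero_mul] at this
    nlinarith [sq_nonneg (z i)]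
  have hA0 : ∀ i, 0 ≤ z i ^ 2 / X i i := fun i => div_nonneg (sq_nonneg _) (hw i)
  have hA : ∑ i, z i ^ 2 / X i i ≤ k * s := by
    have c := hcs (fun i => z i / X i i)
    have d := aux_spart hK (fun i => z i / X i i)
    have e1 : (fun i => z i / X i i) ⬝ᵥ z = ∑ i, z i ^ 2 / X i i :=
      Finset.sum_congr rfl fun i _ => by ring
    have e2 : ∑ i, X i i * (z i / X i i) ^ 2 = ∑ i, z i ^ 2 / X i i :=
      Finset.sum_congr rfl fun i _ => by
        by_cases h : X i i = 0
        · simp [h]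
        · field_simp
    rw [e1] at c
    rw [e2] at d
    have hnn : 0 ≤ ∑ i, z i ^ 2 / X i i := Finset.sum_nonneg fun i _ => hA0 i
    generalize ∑ i, z i ^ 2 / X i i = A at *
    rcases hnn.eq_or_lt with h | h
    · rw [← h]; positivity
    · have := mul_le_mul_of_nonneg_right d hs.le
      have h5 : A * A ≤ A * (k * s) := by nlinarith
      exact le_of_mul_le_mul_left h5 h
  obtain ⟨T, hT, hle⟩ := aux_top hk hkn (fun i => σ i ^ 2) (fun i => z i ^ 2 / X i i / s)
    (fun i => sq_nonneg _) (fun i => div_nonneg (hA0 i) hs.le)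
    (fun i => by
      rw [div_le_one hs]
      exact div_le_of_le_mul₀ (hw i) hs.le (by rw [mul_comm]; exact hzi i))
    (by rw [← Finset.sum_div, div_le_iff₀ hs]; exact hA)
  refine ⟨T, hT, le_trans ?_ hle⟩
  have hfin : (∑ i, σ i * z i) ^ 2 ≤ (∑ i, σ i ^ 2 * (z i ^ 2 / X i i)) * ∑ i, X i i :=
    Finset.sum_sq_le_sum_mul_sum_of_sq_eq_mul _
      (fun i _ => mul_nonneg (sq_nonneg _) (hA0 i)) (fun i _ => hw i) (fun i _ => by
        by_cases h : X i i = 0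
        · simp [hz0 i h]
        · field_simp)
  have htr : ∑ i, X i i = 1 := ht
  have hss : ∑ i, σ i * z i = s := rfl
  rw [htr, hss, mul_one] at hfin
  have e : ∑ i, z i ^ 2 / X i i / s * σ i ^ 2 = (∑ i, σ i ^ 2 * (z i ^ 2 / X i i)) / s := by
    rw [Finset.sum_div]
    exact Finset.sum_congr rfl fun i _ => by ring
  rw [e, le_div_iff₀ hs]
  linarith [sq s]

theorem aux_quad {n : ℕ} (σ x : Fin n → ℝ) :
    x ⬝ᵥ (vecMulVec σ σ *ᵥ x) = (∑ i, σ i * x i) ^ 2 := by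
  rw [vecMulVec_mulVec]
  simp only [dotProduct_smul, op_smul_eq_smul, smul_eq_mul]
  rw [dotProduct_comm x σ, sq]; rfl

theorem aux_tr {n : ℕ} (σ : Fin n → ℝ) (X : Matrix (Fin n) (Fin n) ℝ) :
    (vecMulVec σ σ * X).trace = σ ⬝ᵥ (X *ᵥ σ) := by
  rw [Matrix.trace_mul_comm, mul_vecMulVec, trace_vecMulVec, dotProduct_comm]

theorem aux_lower {n k : ℕ} (σ : Fin n → ℝ) (T : Finset (Fin n)) (hT : T.card = k) (v : ℝ)
    (hv : IsGreatest (PCAVals n k (vecMulVec σ σ)) v) : ∑ i ∈ T, σ i ^ 2 ≤ v := by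
  rcases le_or_gt (∑ i ∈ T, σ i ^ 2) 0 with h | h
  · obtain ⟨x, -, -, hx⟩ := hv.1
    rw [hx, aux_quad]
    exact h.trans (sq_nonneg _)
  · set r := ∑ i ∈ T, σ i ^ 2 with hr
    have hq := Real.sq_sqrt h.le
    have hq0 := Real.sqrt_pos.2 h
    apply hv.2
    refine ⟨fun i => if i ∈ T then σ i / √r else 0, ?_, ?_, ?_⟩
    · simp only [ite_pow, div_pow, hq]
      simp only [ne_eq, OfNat.ofNat_ne_zero, not_false_eq_true, zero_pow, Finset.sum_ite_mem,
        Finset.univ_inter, ← Finset.sum_div]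
      exact div_self h.ne'
    · rw [← hT]
      apply Finset.card_le_card
      intro i hi
      by_contra hn
      simp [hn] at hi
    · rw [aux_quad]
      simp only [mul_ite, mul_zero, Finset.sum_ite_mem, Finset.univ_inter]
      have e : ∑ i ∈ T, σ i * (σ i / √r) = r / √r := by
        rw [hr, Finset.sum_div]
        exact Finset.sum_congr rfl fun i _ => by ring
      rw [e, div_pow, hq]
      field_simp

theorem spca_rank_one_exact (n k : ℕ) (hk : 1 ≤ k) (hkn : k ≤ n)
    (σ : Fin n → ℝ) (M : Matrix (Fin n) (Fin n) ℝ)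
    (hM : M = Matrix.vecMulVec σ σ)
    (vstar vbar : ℝ)
    (hv : IsGreatest (PCAVals n k M) vstar)
    (hvbar : IsGreatest (PCASDPVals n k M) vbar) :
    vbar = vstar ∧
    ∃ x : Fin n → ℝ, (∑ i, (x i) ^ 2) = 1 ∧ sparsity x ≤ k ∧
      Matrix.vecMulVec x x ∈ Spartra n k ∧
      (M * Matrix.vecMulVec x x).trace = vbar := by
  subst hM
  have hle : vbar ≤ vstar := by
    obtain ⟨X, hX, ht, hval⟩ := hvbar.1
    obtain ⟨T, hT, hb⟩ := aux_bound hk hkn σ hX ht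
    rw [hval, aux_tr]
    exact hb.trans (aux_lower σ T hT vstar hv)
  obtain ⟨x, hx1, hx2, hx3⟩ := hv.1
  have hmem := aux_mem x hx2
  have htr : (vecMulVec σ σ * vecMulVec x x).trace = vstar := by
    rw [hx3, Matrix.trace_mul_comm, aux_tr]
  have hge : vstar ≤ vbar := by
    apply hvbar.2
    refine ⟨_, hmem, ?_, htr.symm⟩
    rw [trace_vecMulVec, ← hx1]
    exact Finset.sum_congr rfl fun i _ => by ring
  have heq := le_antisymm hle hge
  exact ⟨heq, x, hx1, hx2, hmem, htr.trans heq.symm⟩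
end
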